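/- arXiv:1412.8527 — 5 statements merged into one kernel-verified Lean document; each statement's English description precedes it below -/
import Mathlib

section
/- Let n ≥ 2 and let E = ℝⁿ with its standard inner product and standard orthonormal basis e₁,…,eₙ. Let ε : E ⊗ E → ℝ be the linear map determined by ε(x ⊗ y) = ⟨x, y⟩, and let η : ℝ → E ⊗ E be the linear map sending 1 to Σᵢ eᵢ ⊗ eᵢ. Then the composite linear map f = (id_E ⊗ η) ∘ (ε ⊗ id_E) : E ⊗ E ⊗ E → E ⊗ E ⊗ E is not injective; in particular f(e₁ ⊗ e₂ ⊗ e₁) = 0 although e₁ ⊗ e₂ ⊗ e₁ ≠ 0. Consequently f is not a linear isomorphism. -/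
open TensorProduct
open scoped RealInnerProductSpace

/-- A pure tensor of nonzero vectors over a field is nonzero. -/
theorem tmul_ne_zero_of_ne_zero {K V W : Type*} [Field K] [AddCommGroup V] [Module K V]
    [AddCommGroup W] [Module K W] {v : V} {w : W} (hv : v ≠ 0) (hw : w ≠ 0) :
    v ⊗ₜ[K] w ≠ 0 := by
  intro h
  obtain ⟨φ, hφ⟩ := not_forall.mp (mt (Module.forall_dual_apply_eq_zero_iff K v).mp hv)
  obtain ⟨ψ, hψ⟩ := not_forall.mp (mt (Module.forall_dual_apply_eq_zero_iff K w).mp hw)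
  have hprod := congrArg ((TensorProduct.lid K K).toLinearMap ∘ₗ TensorProduct.map φ ψ) h
  simp [hφ, hψ] at hprod

/-- The key computation behind Fact 1: for `E = ℝⁿ` with `n ≥ 2`, the
    composite `f = (id_E ⊗ η) ∘ (ε ⊗ id_E) : E ⊗ E ⊗ E → E ⊗ E ⊗ E` built
    from the inner-product counit `ε` and the unit `η` (sending `1` to
    `Σᵢ eᵢ ⊗ eᵢ`) is not injective: it kills `e₁ ⊗ e₂ ⊗ e₁ ≠ 0`, hence `f`
    is not a linear isomorphism. -/
theorem yanked_identity_not_injective (n : ℕ) (hn : 2 ≤ n)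
    (e : Fin n → EuclideanSpace ℝ (Fin n))
    (he : e = fun i => EuclideanSpace.single i (1 : ℝ))
    (ε : EuclideanSpace ℝ (Fin n) ⊗[ℝ] EuclideanSpace ℝ (Fin n) →ₗ[ℝ] ℝ)
    (hε : ∀ x y : EuclideanSpace ℝ (Fin n), ε (x ⊗ₜ y) = ⟪x, y⟫)
    (η : ℝ →ₗ[ℝ] EuclideanSpace ℝ (Fin n) ⊗[ℝ] EuclideanSpace ℝ (Fin n))
    (hη : η 1 = ∑ i : Fin n, e i ⊗ₜ e i)
    (f : (EuclideanSpace ℝ (Fin n) ⊗[ℝ] EuclideanSpace ℝ (Fin n)) ⊗[ℝ] EuclideanSpace ℝ (Fin n)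
      →ₗ[ℝ] EuclideanSpace ℝ (Fin n) ⊗[ℝ] (EuclideanSpace ℝ (Fin n) ⊗[ℝ] EuclideanSpace ℝ (Fin n)))
    (hf : f = (TensorProduct.map LinearMap.id η)
        ∘ₗ (TensorProduct.rid ℝ (EuclideanSpace ℝ (Fin n))).symm.toLinearMap
        ∘ₗ (TensorProduct.lid ℝ (EuclideanSpace ℝ (Fin n))).toLinearMap
        ∘ₗ (TensorProduct.map ε LinearMap.id)) :
    ¬ Function.Injective f ∧
    f ((e ⟨0, by omega⟩ ⊗ₜ e ⟨1, by omega⟩) ⊗ₜ e ⟨0, by omega⟩) = 0 ∧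
    (e ⟨0, by omega⟩ ⊗ₜ e ⟨1, by omega⟩) ⊗ₜ e ⟨0, by omega⟩ ≠ (0 :
      (EuclideanSpace ℝ (Fin n) ⊗[ℝ] EuclideanSpace ℝ (Fin n)) ⊗[ℝ] EuclideanSpace ℝ (Fin n)) ∧
    ¬ Function.Bijective f := by
  have h01 : (⟨0, by omega⟩ : Fin n) ≠ ⟨1, by omega⟩ := by simp
  have e_ne_zero (i : Fin n) : e i ≠ 0 := by simp [he]
  have hzero : f ((e ⟨0, by omega⟩ ⊗ₜ e ⟨1, by omega⟩) ⊗ₜ e ⟨0, by omega⟩) = 0 := by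
    have hε01 : ε (e ⟨0, by omega⟩ ⊗ₜ e ⟨1, by omega⟩) = 0 := by
      rw [hε, he]
      simp [EuclideanSpace.inner_single_left, h01]
    simp [hf, hε01]
  have hne : (e ⟨0, by omega⟩ ⊗ₜ e ⟨1, by omega⟩) ⊗ₜ e ⟨0, by omega⟩ ≠ (0 :
      (EuclideanSpace ℝ (Fin n) ⊗[ℝ] EuclideanSpace ℝ (Fin n)) ⊗[ℝ] EuclideanSpace ℝ (Fin n)) := by
    exact tmul_ne_zero_of_ne_zero (tmul_ne_zero_of_ne_zero (e_ne_zero _) (e_ne_zero _))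
      (e_ne_zero _)
  have hinj : ¬ Function.Injective f := fun h => hne (h (hzero.trans (map_zero f).symm))
  exact ⟨hinj, hzero, hne, fun h => hinj h.injective⟩
end

section
/- Let p : ℝⁿ → S be a predicate on the standard basis A = {e₁,…,eₙ}, and let X = Σᵢ αᵢeᵢ be a nonzero vector with αᵢ ≥ 0 for all i; let X̄ = {i : αᵢ ≠ 0}. Then p(X) is colinear to ⊤ (i.e., p(X) = c • ⊤ for some scalar c ≠ 0) if and only if p(eᵢ) = ⊤ for every i ∈ X̄. -/
/-- Fundamental Property, first clause: for a linear predicate `p : ℝⁿ → ℝ²`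
    on the standard basis (`⊤ = Pi.single 0 1`, `⊥ = Pi.single 1 1`) and a
    nonzero vector `X` with nonnegative coordinates, `p X` is colinear to `⊤`
    iff `p eᵢ = ⊤` for every `i` with `X i ≠ 0`. -/
theorem fundamental_property_true (n : ℕ) (p : (Fin n → ℝ) →ₗ[ℝ] (Fin 2 → ℝ))
    (hp : ∀ i : Fin n,
      p (Pi.single i 1) = Pi.single 0 1 ∨ p (Pi.single i 1) = Pi.single 1 1)
    (X : Fin n → ℝ) (hX : X ≠ 0) (hXpos : ∀ i, 0 ≤ X i) :
    (∃ c : ℝ, c ≠ 0 ∧ p X = c • (Pi.single 0 1 : Fin 2 → ℝ)) ↔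
      (∀ i, X i ≠ 0 → p (Pi.single i 1) = Pi.single 0 1) := by
  have hsum : p X = ∑ i, X i • p (Pi.single i 1) := by
    conv_lhs => rw [← Finset.univ_sum_single X]
    rw [map_sum]
    refine Finset.sum_congr rfl fun i _ => ?_
    rw [← map_smul, ← Pi.single_smul, smul_eq_mul, mul_one]
  constructor
  · rintro ⟨c, -, hc⟩ i hi
    refine (hp i).resolve_right fun hbot => hi ?_
    have hzero : ∑ j, X j * p (Pi.single j 1) 1 = 0 := by
      simpa [hsum] using congrFun hc 1
    have hnonneg : ∀ j ∈ Finset.univ, 0 ≤ X j * p (Pi.single j 1) 1 := fun j _ =>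
      mul_nonneg (hXpos j) (by rcases hp j with h | h <;> simp [h])
    simpa [hbot] using (Finset.sum_eq_zero_iff_of_nonneg hnonneg).1 hzero i (Finset.mem_univ i)
  · intro h
    refine ⟨∑ i, X i, fun h0 => hX ?_, ?_⟩
    · funext i
      exact (Finset.sum_eq_zero_iff_of_nonneg fun j _ => hXpos j).1 h0 i (Finset.mem_univ i)
    · rw [hsum, Finset.sum_smul]
      refine Finset.sum_congr rfl fun i _ => ?_
      by_cases hi : X i = 0
      · simp [hi]
      · rw [h i hi]
end

section
/- Let p, q be linear endomorphisms of the Euclidean space ℝⁿ (with standard inner product) that are orthogonal projections, i.e., idempotent and self-adjoint. If q ∘ p = p, then p + q − p ∘ q is the orthogonal projection onto the subspace range(p) + range(q); that is, p + q − p ∘ q is idempotent, self-adjoint, its range is range(p) + range(q), and it fixes every vector of range(p) + range(q). -/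
open scoped RealInnerProductSpace

/-- If `p` and `q` are symmetric and `q` fixes the range of `p`, then `p` absorbs `q` on the
right. -/
lemma LinearMap.IsSymmetric.comp_eq_left_of_comp_eq_right {E : Type*} [NormedAddCommGroup E]
    [InnerProductSpace ℝ E] {p q : E →ₗ[ℝ] E} (hp : p.IsSymmetric) (hq : q.IsSymmetric)
    (h : q ∘ₗ p = p) : p ∘ₗ q = p := by
  ext x
  refine ext_inner_right ℝ fun y => ?_
  rw [LinearMap.comp_apply, hp, hq, ← LinearMap.comp_apply, h, hp]

/-- If `p`, `q` are orthogonal projections (idempotent and self-adjoint) of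
    Euclidean space `ℝⁿ` with `q ∘ p = p`, then the algebraic disjunction
    `p + q − p ∘ q` is the orthogonal projection onto `range p ⊔ range q`: it
    is idempotent, self-adjoint, has range `range p ⊔ range q`, and fixes
    every vector of `range p ⊔ range q`. -/
theorem algebraic_disjunction_is_projection_onto_sup {n : ℕ}
    (p q : EuclideanSpace ℝ (Fin n) →ₗ[ℝ] EuclideanSpace ℝ (Fin n))
    (hp_idem : p ∘ₗ p = p) (hq_idem : q ∘ₗ q = q)
    (hp_sa : ∀ x y : EuclideanSpace ℝ (Fin n), ⟪p x, y⟫ = ⟪x, p y⟫)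
    (hq_sa : ∀ x y : EuclideanSpace ℝ (Fin n), ⟪q x, y⟫ = ⟪x, q y⟫)
    (h : q ∘ₗ p = p) :
    (p + q - p ∘ₗ q) ∘ₗ (p + q - p ∘ₗ q) = p + q - p ∘ₗ q ∧
    (∀ x y : EuclideanSpace ℝ (Fin n), ⟪(p + q - p ∘ₗ q) x, y⟫ = ⟪x, (p + q - p ∘ₗ q) y⟫) ∧
    LinearMap.range (p + q - p ∘ₗ q) = LinearMap.range p ⊔ LinearMap.range q ∧
    (∀ x ∈ LinearMap.range p ⊔ LinearMap.range q, (p + q - p ∘ₗ q) x = x) := by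
  have hpq : p ∘ₗ q = p :=
    LinearMap.IsSymmetric.comp_eq_left_of_comp_eq_right hp_sa hq_sa h
  have hle : LinearMap.range p ≤ LinearMap.range q := h ▸ LinearMap.range_comp_le_range p q
  rw [hpq, add_sub_cancel_left, sup_eq_right.mpr hle]
  refine ⟨hq_idem, hq_sa, rfl, ?_⟩
  rintro _ ⟨x, rfl⟩
  exact LinearMap.congr_fun hq_idem x
end

section
/- Let A be a finite nonempty set and C₁,…,C_k a partition of A into nonempty subsets, and let p, q : A → Bool. Assume that for every j, p is constant on C_j or q is constant on C_j. Then for every j, α_{p→q, j} = 1 − α_{p,j} + α_{p,j} · α_{q,j}, where p→q is the pointwise Boolean implication a ↦ (!p(a) || q(a)). -/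
/-- The conditional probability `α_{p,j} = |{a ∈ C_j : p a}| / |C_j|`. -/
noncomputable def condProb {A : Type*} [DecidableEq A] (C : Finset A) (p : A → Bool) : ℝ :=
  ((C.filter (fun a => p a = true)).card : ℝ) / (C.card : ℝ)

namespace condProb

variable {A : Type*} [DecidableEq A] {C : Finset A} {p q : A → Bool}

theorem congr (h : ∀ a ∈ C, p a = q a) : condProb C p = condProb C q := by
  unfold condProb
  rw [Finset.filter_congr fun a ha => by rw [h a ha]]

theorem of_forall_true (hC : C.Nonempty) (h : ∀ a ∈ C, p a = true) : condProb C p = 1 := by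
  unfold condProb
  rw [Finset.filter_true_of_mem h]
  exact div_self (Nat.cast_ne_zero.mpr hC.card_ne_zero)

theorem of_forall_false (h : ∀ a ∈ C, p a = false) : condProb C p = 0 := by
  unfold condProb
  rw [Finset.filter_false_of_mem fun a ha => by simp [h a ha]]
  simp

theorem not (hC : C.Nonempty) (p : A → Bool) :
    condProb C (fun a => !p a) = 1 - condProb C p := by
  have hcard : (C.card : ℝ) ≠ 0 := Nat.cast_ne_zero.mpr hC.card_ne_zero
  have hsum : ((C.filter fun a => p a = true).card : ℝ) +
      (C.filter fun a => (!p a) = true).card = C.card := by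
    have := Finset.card_filter_add_card_filter_not (s := C) (fun a => p a = true)
    simp only [Bool.not_eq_true', ← Bool.not_eq_true]
    exact_mod_cast this
  unfold condProb
  rw [eq_sub_iff_add_eq, ← add_div, add_comm, hsum, div_self hcard]

end condProb

/-- Implication clause of Lemma 1: if each class of a partition of a finite
    nonempty set is nonempty and on each class `p` or `q` is constant, then
    `α_{p→q,j} = 1 − α_{p,j} + α_{p,j} · α_{q,j}`. -/
theorem condProb_imp {A : Type*} [Fintype A] [DecidableEq A] [Nonempty A]
    {k : ℕ} (C : Fin k → Finset A)
    (hne : ∀ j, (C j).Nonempty)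
    (hdisj : ∀ i j, i ≠ j → Disjoint (C i) (C j))
    (hcover : ∀ a : A, ∃ j, a ∈ C j)
    (p q : A → Bool)
    (hconst : ∀ j, (∀ a ∈ C j, ∀ b ∈ C j, p a = p b) ∨ (∀ a ∈ C j, ∀ b ∈ C j, q a = q b)) :
    ∀ j, condProb (C j) (fun a => !p a || q a) =
      1 - condProb (C j) p + condProb (C j) p * condProb (C j) q := by
  intro j
  have hj := hne j
  obtain ⟨c, hc⟩ := hne j
  rcases hconst j with h | h
  · cases hpc : p c with
    | false =>
      have hp : ∀ a ∈ C j, p a = false := fun a ha => (h a ha c hc).trans hpc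
      rw [condProb.of_forall_true hj fun a ha => by simp [hp a ha],
        condProb.of_forall_false hp]
      ring
    | true =>
      have hp : ∀ a ∈ C j, p a = true := fun a ha => (h a ha c hc).trans hpc
      rw [condProb.congr (q := q) fun a ha => by simp [hp a ha],
        condProb.of_forall_true hj hp]
      ring
  · cases hqc : q c with
    | false =>
      have hq : ∀ a ∈ C j, q a = false := fun a ha => (h a ha c hc).trans hqc
      rw [condProb.congr (q := fun a => !p a) fun a ha => by simp [hq a ha],
        condProb.not hj, condProb.of_forall_false hq]
      ring
    | true =>
      have hq : ∀ a ∈ C j, q a = true := fun a ha => (h a ha c hc).trans hqc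
      rw [condProb.of_forall_true hj fun a ha => by simp [hq a ha],
        condProb.of_forall_true hj hq]
      ring
end

section
/- Let A be a finite nonempty set and C₁,…,C_k a partition of A into nonempty subsets, and let p, q : A → Bool. If for every j one has 1 − α_{p,j} + α_{p,j} · α_{q,j} = 1, then for every a ∈ A, p(a) = true implies q(a) = true. -/
theorem condProb_ne_zero {A : Type*} [DecidableEq A] {C : Finset A} {p : A → Bool} {a : A}
    (ha : a ∈ C) (hp : p a = true) : condProb C p ≠ 0 := by
  have hC : C.card ≠ 0 := Finset.card_ne_zero_of_mem ha
  have hF : (C.filter (fun a => p a = true)).card ≠ 0 :=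
    Finset.card_ne_zero_of_mem (Finset.mem_filter.2 ⟨ha, hp⟩)
  exact div_ne_zero (Nat.cast_ne_zero.2 hF) (Nat.cast_ne_zero.2 hC)

theorem forall_mem_of_condProb_eq_one {A : Type*} [DecidableEq A] {C : Finset A} {p : A → Bool}
    (h : condProb C p = 1) : ∀ a ∈ C, p a = true := by
  have hcard : (C.filter (fun a => p a = true)).card = C.card := by
    exact_mod_cast eq_of_div_eq_one h
  exact Finset.card_filter_eq_iff.1 hcard

/-- Consequence-reflection clause of Theorem 1: if for every class of a
    partition of a finite nonempty set into nonempty classes the algebraic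
    implication `1 − α_{p,j} + α_{p,j}·α_{q,j}` equals 1, then `q` is a
    logical consequence of `p`. -/
theorem condProb_consequence_reflection {A : Type*} [Fintype A] [DecidableEq A] [Nonempty A]
    {k : ℕ} (C : Fin k → Finset A)
    (hne : ∀ j, (C j).Nonempty)
    (hdisj : ∀ i j, i ≠ j → Disjoint (C i) (C j))
    (hcover : ∀ a : A, ∃ j, a ∈ C j)
    (p q : A → Bool)
    (h : ∀ j, 1 - condProb (C j) p + condProb (C j) p * condProb (C j) q = 1) :
    ∀ a : A, p a = true → q a = true := by
  intro a hp
  obtain ⟨j, ha⟩ := hcover a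
  have hpq : condProb (C j) p * condProb (C j) q = condProb (C j) p := by linarith [h j]
  exact forall_mem_of_condProb_eq_one (mul_eq_left₀ (condProb_ne_zero ha hp) |>.1 hpq) a ha
end
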